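/- Let (X,G) ~ SSBM(n,2,p_n,q_n) with labels in {+1,−1}, let λ > 0, let SNR_n := n(p_n−q_n)²/(2(p_n+q_n)(1−(p_n+q_n)/2)), and let Y = √(λ/n)·XX^T + Z be the spiked Wigner observation, where Z is an n×n symmetric random matrix with independent N(0,1) entries above the diagonal (independent of X). Then there is a constant C, independent of n, such that (1/n)·|I(X;G) − I(X;Y)| ≤ C·( λ^{3/2}/√(n(p_n+q_n)/2·(1−(p_n+q_n)/2)) + |SNR_n − λ| ). -/

import Mathlib

open Filter MeasureTheory
open scoped Classical

abbrev VPair (n : ℕ) := {e : Fin n × Fin n // e.1 < e.2}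

/-- Spin value of a Boolean label. -/
noncomputable def chi (b : Bool) : ℝ := if b then 1 else -1

/-- Joint mass of labels `x ∈ {±1}ⁿ` (i.i.d. uniform) and graph `g` in
`SSBM(n, 2, p, q)`. -/
noncomputable def ssbm2Mass (n : ℕ) (p q : ℝ) (x : Fin n → Bool) (g : VPair n → Bool) : ℝ :=
  ((1 : ℝ) / 2) ^ n *
    ∏ e : VPair n,
      if g e then (if x e.1.1 = x e.1.2 then p else q)
      else 1 - (if x e.1.1 = x e.1.2 then p else q)

/-- Marginal probability of the graph `g`. -/
noncomputable def graphMarg (n : ℕ) (p q : ℝ) (g : VPair n → Bool) : ℝ :=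
  ∑ x : Fin n → Bool, ssbm2Mass n p q x g

/-- Mutual information `I(X; G)` between the labels and the graph. -/
noncomputable def miSBM (n : ℕ) (p q : ℝ) : ℝ :=
  ∑ x : Fin n → Bool, ∑ g : VPair n → Bool,
    ssbm2Mass n p q x g *
      Real.log (ssbm2Mass n p q x g / (((1 : ℝ) / 2) ^ n * graphMarg n p q g))

/-- Density of the spiked Wigner observation `Y = √(λ/n) XXᵀ + Z` given labels `x`,
as a function of the off-diagonal entries `y`. -/
noncomputable def gaussDensity (n : ℕ) (lam : ℝ) (x : Fin n → Bool) (y : VPair n → ℝ) : ℝ :=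
  ∏ e : VPair n,
    Real.exp (-(y e - Real.sqrt (lam / n) * (chi (x e.1.1) * chi (x e.1.2))) ^ 2 / 2) /
      Real.sqrt (2 * Real.pi)

/-- Mutual information `I(X; Y)` between uniform spins `X ∈ {±1}ⁿ` and the spiked
Wigner observation `Y = √(λ/n) XXᵀ + Z`, written as
`E log (p(Y|X)/p(Y))` over the signal-plus-Gaussian-noise observation. -/
noncomputable def miGauss (n : ℕ) (lam : ℝ) : ℝ :=
  ((1 : ℝ) / 2) ^ n *
    ∑ x : Fin n → Bool,
      ∫ z : VPair n → ℝ,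
        Real.log
          (gaussDensity n lam x
              (fun e => z e + Real.sqrt (lam / n) * (chi (x e.1.1) * chi (x e.1.2))) /
            (((1 : ℝ) / 2) ^ n *
              ∑ x' : Fin n → Bool,
                gaussDensity n lam x'
                  (fun e => z e + Real.sqrt (lam / n) * (chi (x e.1.1) * chi (x e.1.2)))))
        ∂(Measure.pi fun _ : VPair n => ProbabilityTheory.gaussianReal 0 1)


section Entropy

open Real

/-- Taylor expansion of `negMulLog` at `1` to second order, with a cubic error valid on the whole
half-line. -/
lemma abs_negMulLog_add_le {w : ℝ} (hw : 0 ≤ w) :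
    |negMulLog w + (w - 1) + (w - 1) ^ 2 / 2| ≤ 15 * |w - 1| ^ 3 := by
  rcases lt_or_ge |w - 1| (1 / 2) with h | h
  · have hx : |1 - w| < 1 := by rw [abs_sub_comm]; linarith
    have key := Real.abs_log_sub_add_sum_range_le hx 2
    rw [abs_sub_comm 1 w] at key
    have h3 : |w - 1| ^ (2 + 1) / (1 - |w - 1|) ≤ 2 * |w - 1| ^ 3 := by
      rw [div_le_iff₀ (by linarith)]
      have h0 := mul_nonneg (pow_nonneg (abs_nonneg (w - 1)) 3) (sub_nonneg.mpr h.le)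
      norm_num at h0 ⊢
      linarith
    have key' := key.trans h3
    simp only [Finset.sum_range_succ, Finset.sum_range_zero] at key'
    norm_num at key'
    set r := 1 - w + (1 - w) ^ 2 / 2 + log w with hr
    have hlog : log w = r - (1 - w) - (1 - w) ^ 2 / 2 := by rw [hr]; ring
    have heq : negMulLog w + (w - 1) + (w - 1) ^ 2 / 2 = (w - 1) ^ 3 / 2 - w * r := by
      rw [negMulLog, hlog]; ring
    rw [heq]
    have hw2 : w ≤ 3 / 2 := by linarith [(abs_lt.mp h).2]
    calc |(w - 1) ^ 3 / 2 - w * r| ≤ |(w - 1) ^ 3 / 2| + |w * r| := abs_sub _ _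
      _ = |w - 1| ^ 3 / 2 + w * |r| := by
        rw [abs_div, abs_pow, abs_mul, abs_of_nonneg hw]; norm_num
      _ ≤ |w - 1| ^ 3 / 2 + (3 / 2) * (2 * |w - 1| ^ 3) := by gcongr
      _ ≤ 15 * |w - 1| ^ 3 := by nlinarith [pow_nonneg (abs_nonneg (w - 1)) 3]
  · have h1 : w - 1 ≤ w * log w := by
      rcases hw.eq_or_lt with rfl | hpos
      · norm_num
      · have := Real.one_sub_inv_le_log_of_pos hpos
        calc w - 1 = w * (1 - w⁻¹) := by field_simp
          _ ≤ w * log w := by gcongr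
    have h2 : w * log w ≤ w * (w - 1) := by
      rcases hw.eq_or_lt with rfl | hpos
      · norm_num
      · have := Real.log_le_sub_one_of_pos hpos
        gcongr
    rw [negMulLog]
    set d := |w - 1| with hd
    have hsq : (w - 1) ^ 2 = d ^ 2 := (sq_abs _).symm
    have hd2 : d ^ 2 ≤ 2 * d ^ 3 := by nlinarith [sq_nonneg d]
    have hd1 : d ≤ 4 * d ^ 3 := by nlinarith [sq_nonneg d]
    have hle := le_abs_self (w - 1)
    have hge := neg_abs_le (w - 1)
    rw [abs_le]
    constructor <;> nlinarith

/-- The Shannon entropy of the weight vector `v`, extended to unnormalised nonnegative weights by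
homogeneity. -/
noncomputable def weightEntropy {X : Type*} [Fintype X] (v : X → ℝ) : ℝ :=
  ∑ x, negMulLog (v x) - negMulLog (∑ x, v x)

lemma weightEntropy_eq_sum {X : Type*} [Fintype X] (v : X → ℝ) :
    weightEntropy v = ∑ x, v x * (log (∑ y, v y) - log (v x)) := by
  simp only [weightEntropy, negMulLog, mul_sub, Finset.sum_sub_distrib, ← Finset.sum_mul,
    Finset.sum_neg_distrib, neg_mul]
  ring

lemma mul_log_sub_log_nonneg {X : Type*} [Fintype X] {v : X → ℝ} (hv : ∀ x, 0 ≤ v x) (x : X) :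
    0 ≤ v x * (log (∑ y, v y) - log (v x)) := by
  rcases (hv x).eq_or_lt with h | h
  · simp [← h]
  · refine mul_nonneg h.le (sub_nonneg.mpr (log_le_log h ?_))
    exact Finset.single_le_sum (fun y _ => hv y) (Finset.mem_univ x)

lemma weightEntropy_nonneg {X : Type*} [Fintype X] {v : X → ℝ} (hv : ∀ x, 0 ≤ v x) :
    0 ≤ weightEntropy v := by
  rw [weightEntropy_eq_sum]
  exact Finset.sum_nonneg fun x _ => mul_log_sub_log_nonneg hv x

lemma weightEntropy_le {X : Type*} [Fintype X] {v : X → ℝ} (hv : ∀ x, 0 ≤ v x) :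
    weightEntropy v ≤ (∑ x, v x) * log (Fintype.card X) := by
  rw [weightEntropy_eq_sum]
  set s := ∑ x, v x with hs
  have hs0 : 0 ≤ s := Finset.sum_nonneg fun x _ => hv x
  rcases hs0.eq_or_lt with h0 | hpos
  · have : ∀ x, v x = 0 := fun x =>
      (Finset.sum_eq_zero_iff_of_nonneg fun x _ => hv x).mp (hs.symm.trans h0.symm) x
        (Finset.mem_univ x)
    simp [this, ← h0]
  have hne : (Finset.univ : Finset X).Nonempty := by
    by_contra h
    rw [Finset.not_nonempty_iff_eq_empty] at h
    simp [hs, h] at hpos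
  have hN : (0 : ℝ) < Fintype.card X := by
    rw [← Finset.card_univ]; exact_mod_cast hne.card_pos
  have hterm : ∀ x, v x * (log s - log (v x)) - v x * log (Fintype.card X) ≤
      s / Fintype.card X - v x := by
    intro x
    rcases (hv x).eq_or_lt with h | h
    · rw [← h]; simp; positivity
    · have h1 := log_le_sub_one_of_pos (show 0 < s / (v x * Fintype.card X) by positivity)
      rw [log_div hpos.ne' (by positivity), log_mul h.ne' hN.ne'] at h1
      calc _ = v x * (log s - (log (v x) + log (Fintype.card X))) := by ring
        _ ≤ v x * (s / (v x * Fintype.card X) - 1) := by gcongr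
        _ = _ := by field_simp
  have hsum := Finset.sum_le_sum fun x (_ : x ∈ Finset.univ) => hterm x
  rw [Finset.sum_sub_distrib, Finset.sum_sub_distrib, ← Finset.sum_mul, ← hs, Finset.sum_const,
    Finset.card_univ, nsmul_eq_mul, mul_div_cancel₀ _ hN.ne'] at hsum
  linarith

lemma weightEntropy_const_mul {X : Type*} [Fintype X] (c : ℝ) (v : X → ℝ) :
    weightEntropy (fun x => c * v x) = c * weightEntropy v := by
  simp only [weightEntropy, ← Finset.mul_sum, negMulLog_mul, Finset.sum_add_distrib,
    ← Finset.sum_mul]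
  ring

lemma measurable_weightEntropy {X Ω : Type*} [Fintype X] [MeasurableSpace Ω] {v : X → Ω → ℝ}
    (hv : ∀ x, Measurable (v x)) : Measurable fun ω => weightEntropy fun x => v x ω := by
  have hm : Measurable negMulLog := continuous_negMulLog.measurable
  refine Measurable.sub ?_ ?_
  · exact Finset.measurable_sum _ fun x _ => hm.comp (hv x)
  · exact hm.comp (Finset.measurable_sum _ fun x _ => hv x)

lemma integrable_weightEntropy {X Ω : Type*} [Fintype X] [MeasurableSpace Ω] {μ : Measure Ω}
    {v : X → Ω → ℝ} (hv : ∀ x, Measurable (v x)) (hi : ∀ x, Integrable (v x) μ)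
    (h0 : ∀ x ω, 0 ≤ v x ω) : Integrable (fun ω => weightEntropy fun x => v x ω) μ := by
  refine Integrable.mono' ((integrable_finsetSum Finset.univ fun x _ => hi x).mul_const
    (log (Fintype.card X))) (measurable_weightEntropy hv).aestronglyMeasurable
    (Filter.Eventually.of_forall fun ω => ?_)
  rw [norm_eq_abs, abs_of_nonneg (weightEntropy_nonneg fun x => h0 x ω)]
  exact weightEntropy_le fun x => h0 x ω

/-- `w` is a probability density with respect to `μ`. -/
structure IsProbDensity {Ω : Type*} [MeasurableSpace Ω] (μ : Measure Ω) (w : Ω → ℝ) : Prop where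
  measurable : Measurable w
  nonneg : ∀ ω, 0 ≤ w ω
  integrable : Integrable w μ
  integral_eq_one : ∫ ω, w ω ∂μ = 1

lemma isProbDensity_one {Ω : Type*} [MeasurableSpace Ω] (μ : Measure Ω) [IsProbabilityMeasure μ] :
    IsProbDensity μ fun _ => 1 :=
  ⟨measurable_const, fun _ => zero_le_one, integrable_const 1, by simp⟩

lemma IsProbDensity.pi {ι Ω : Type*} [Fintype ι] [MeasurableSpace Ω] {μ : Measure Ω}
    [IsProbabilityMeasure μ] {w : ι → Ω → ℝ} (hw : ∀ i, IsProbDensity μ (w i)) :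
    IsProbDensity (Measure.pi fun _ : ι => μ) fun y => ∏ i, w i (y i) where
  measurable := Finset.measurable_prod _ fun i _ => (hw i).measurable.comp (measurable_pi_apply i)
  nonneg y := Finset.prod_nonneg fun i _ => (hw i).nonneg _
  integrable := Integrable.fintype_prod fun i => (hw i).integrable
  integral_eq_one := by
    rw [integral_fintype_prod_eq_prod]
    exact Finset.prod_eq_one fun i _ => (hw i).integral_eq_one

lemma measurable_update_prod {ι Ω : Type*} [DecidableEq ι] [MeasurableSpace Ω] (e : ι) :
    Measurable fun z : (ι → Ω) × Ω => Function.update z.1 e z.2 := by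
  rw [measurable_pi_iff]
  intro i
  by_cases h : i = e
  · subst h; simpa using measurable_snd
  · simp only [ne_eq, h, not_false_eq_true, Function.update_of_ne]
    fun_prop

lemma map_update_pi_prod {ι Ω : Type*} [Fintype ι] [DecidableEq ι] [MeasurableSpace Ω]
    (μ : Measure Ω) [IsProbabilityMeasure μ] (e : ι) :
    ((Measure.pi fun _ : ι => μ).prod μ).map (fun z => Function.update z.1 e z.2) =
      Measure.pi fun _ : ι => μ := by
  have hmeas := measurable_update_prod (Ω := Ω) e
  refine (Measure.pi_eq fun s hs => ?_).symm
  rw [Measure.map_apply hmeas (MeasurableSet.univ_pi hs)]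
  have hpre : (fun z : (ι → Ω) × Ω => Function.update z.1 e z.2) ⁻¹' Set.univ.pi s =
      (Set.univ.pi (Function.update s e Set.univ)) ×ˢ s e := by
    ext ⟨y, t⟩
    simp only [Set.mem_preimage, Set.mem_univ_pi, Set.mem_prod]
    constructor
    · intro h
      refine ⟨fun i => ?_, by simpa using h e⟩
      by_cases hi : i = e
      · subst hi; simp
      · simpa [hi] using h i
    · rintro ⟨h1, h2⟩ i
      by_cases hi : i = e
      · subst hi; simpa using h2
      · simpa [hi] using h1 i
  rw [hpre, Measure.prod_prod, Measure.pi_pi,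
    ← Finset.mul_prod_erase Finset.univ (fun i => μ (s i)) (Finset.mem_univ e),
    ← Finset.mul_prod_erase Finset.univ (fun i => μ (Function.update s e Set.univ i))
      (Finset.mem_univ e)]
  simp only [Function.update_self, measure_univ, one_mul]
  rw [mul_comm]
  congr 1
  refine Finset.prod_congr rfl fun i hi => ?_
  rw [Function.update_of_ne (Finset.ne_of_mem_erase hi)]

lemma abs_integral_weightEntropy_update_sub_le {ι X Ω : Type*} [Fintype ι] [DecidableEq ι]
    [Fintype X] [MeasurableSpace Ω] {μ : Measure Ω} [IsProbabilityMeasure μ]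
    {W : ι → X → Ω → ℝ} (hW : ∀ i x, IsProbDensity μ (W i x)) (e : ι) {A B : X → Ω → ℝ}
    (hA : ∀ x, IsProbDensity μ (A x)) (hB : ∀ x, IsProbDensity μ (B x)) {ε : ℝ}
    (hAB : ∀ u : X → ℝ, (∀ x, 0 ≤ u x) →
      |∫ ω, weightEntropy (fun x => u x * A x ω) ∂μ - ∫ ω, weightEntropy (fun x => u x * B x ω) ∂μ|
        ≤ ε * ∑ x, u x) {u : X → ℝ} (hu : ∀ x, 0 ≤ u x) :
    |∫ y, weightEntropy (fun x => u x * ∏ i, Function.update W e A i x (y i))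
          ∂(Measure.pi fun _ : ι => μ) -
        ∫ y, weightEntropy (fun x => u x * ∏ i, Function.update W e B i x (y i))
          ∂(Measure.pi fun _ : ι => μ)| ≤ ε * ∑ x, u x := by
  set ν := Measure.pi fun _ : ι => μ with hν
  set V := Function.update W e (fun _ _ => 1) with hV
  have hupd : ∀ {D : X → Ω → ℝ}, (∀ x, IsProbDensity μ (D x)) → ∀ x i,
      IsProbDensity μ (Function.update W e D i x) := by
    intro D hD x i
    by_cases h : i = e
    · subst h; simpa using hD x
    · simpa [h] using hW i x
  have hVd : ∀ x, IsProbDensity ν fun y => ∏ i, V i x (y i) := fun x =>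
    IsProbDensity.pi (hupd (fun _ => isProbDensity_one μ) x)
  have hmeas := measurable_update_prod (Ω := Ω) e
  have hprod : ∀ (D : X → Ω → ℝ) (x : X) (y : ι → Ω) (t : Ω),
      ∏ i, Function.update W e D i x (Function.update y e t i) =
        (∏ i, V i x (y i)) * D x t := by
    intro D x y t
    rw [← Finset.mul_prod_erase Finset.univ _ (Finset.mem_univ e),
      ← Finset.mul_prod_erase Finset.univ (fun i => V i x (y i)) (Finset.mem_univ e)]
    simp only [hV, Function.update_self, one_mul]
    rw [mul_comm]
    congr 1
    refine Finset.prod_congr rfl fun i hi => ?_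
    simp [Finset.ne_of_mem_erase hi]
  have hmain : ∀ {D : X → Ω → ℝ}, (∀ x, IsProbDensity μ (D x)) →
      Integrable (fun y => ∫ t, weightEntropy (fun x => u x * (∏ i, V i x (y i)) * D x t) ∂μ) ν ∧
      ∫ y, weightEntropy (fun x => u x * ∏ i, Function.update W e D i x (y i)) ∂ν =
        ∫ y, ∫ t, weightEntropy (fun x => u x * (∏ i, V i x (y i)) * D x t) ∂μ ∂ν := by
    intro D hD
    have hd : ∀ x, IsProbDensity ν fun y => ∏ i, Function.update W e D i x (y i) :=
      fun x => IsProbDensity.pi (hupd hD x)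
    have hi1 : Integrable
        (fun y => weightEntropy (fun x => u x * ∏ i, Function.update W e D i x (y i))) ν :=
      integrable_weightEntropy (fun x => (hd x).measurable.const_mul (u x))
        (fun x => (hd x).integrable.const_mul (u x))
        (fun x y => mul_nonneg (hu x) ((hd x).nonneg y))
    rw [hν, ← map_update_pi_prod μ e] at hi1
    have hi2 := hi1.comp_measurable hmeas
    simp only [Function.comp_def, hprod, ← mul_assoc] at hi2
    refine ⟨hi2.integral_prod_left, ?_⟩
    rw [← integral_prod _ hi2, hν]
    conv_lhs => rw [← map_update_pi_prod μ e]
    rw [integral_map hmeas.aemeasurable hi1.aestronglyMeasurable]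
    simp only [hprod, ← mul_assoc]
  rw [(hmain hA).2, (hmain hB).2, ← integral_sub (hmain hA).1 (hmain hB).1]
  have hbint : Integrable (fun y => ε * ∑ x, u x * ∏ i, V i x (y i)) ν :=
    (integrable_finsetSum Finset.univ fun x _ => (hVd x).integrable.const_mul (u x)).const_mul ε
  calc _ ≤ ∫ y, ε * ∑ x, u x * ∏ i, V i x (y i) ∂ν := by
        rw [← Real.norm_eq_abs]
        refine norm_integral_le_of_norm_le hbint (Filter.Eventually.of_forall fun y => ?_)
        exact hAB _ fun x => mul_nonneg (hu x) ((hVd x).nonneg y)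
    _ = ε * ∑ x, u x := by
        rw [integral_const_mul, integral_finsetSum _
          fun x _ => (hVd x).integrable.const_mul (u x)]
        simp only [integral_const_mul, (hVd _).integral_eq_one, mul_one]

/-- Swapping the observation channels one coordinate at a time changes the expected entropy by at
most the sum of the single-channel changes. -/
lemma abs_integral_weightEntropy_prod_sub_le {ι X Ω : Type*} [Fintype ι]
    [Fintype X] [MeasurableSpace Ω] {μ : Measure Ω} [IsProbabilityMeasure μ]
    {A B : ι → X → Ω → ℝ} (hA : ∀ i x, IsProbDensity μ (A i x))
    (hB : ∀ i x, IsProbDensity μ (B i x)) {ε : ℝ}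
    (hAB : ∀ (i : ι) (u : X → ℝ), (∀ x, 0 ≤ u x) →
      |∫ ω, weightEntropy (fun x => u x * A i x ω) ∂μ -
        ∫ ω, weightEntropy (fun x => u x * B i x ω) ∂μ| ≤ ε * ∑ x, u x)
    {u : X → ℝ} (hu : ∀ x, 0 ≤ u x) :
    |∫ y, weightEntropy (fun x => u x * ∏ i, A i x (y i)) ∂(Measure.pi fun _ : ι => μ) -
        ∫ y, weightEntropy (fun x => u x * ∏ i, B i x (y i)) ∂(Measure.pi fun _ : ι => μ)| ≤
      Fintype.card ι * (ε * ∑ x, u x) := by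
  classical
  have key : ∀ S : Finset ι,
      |∫ y, weightEntropy (fun x => u x * ∏ i, (if i ∈ S then A i else B i) x (y i))
          ∂(Measure.pi fun _ : ι => μ) -
        ∫ y, weightEntropy (fun x => u x * ∏ i, B i x (y i)) ∂(Measure.pi fun _ : ι => μ)| ≤
      S.card * (ε * ∑ x, u x) := by
    intro S
    induction S using Finset.induction_on with
    | empty => simp
    | insert e S he ih =>
      set W : ι → X → Ω → ℝ := fun i => if i ∈ S then A i else B i with hWdef
      have hW : ∀ i x, IsProbDensity μ (W i x) := by
        intro i x
        simp only [hWdef]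
        split_ifs
        exacts [hA i x, hB i x]
      have h := abs_integral_weightEntropy_update_sub_le hW e (hA e) (hB e) (hAB e) hu
      have h1 : Function.update W e (A e) = fun i => if i ∈ insert e S then A i else B i := by
        funext i
        by_cases hi : i = e
        · subst hi; simp
        · simp [hi, hWdef]
      have h2 : Function.update W e (B e) = W := by
        rw [Function.update_eq_self_iff]
        simp [hWdef, he]
      rw [h1, h2] at h
      rw [Finset.card_insert_of_notMem he]
      push_cast
      calc _ ≤ _ := abs_sub_le _ _ _
        _ ≤ _ := add_le_add h ih
        _ = _ := by ring
  simpa using key Finset.univ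

lemma sum_mul_comp_bool {X : Type*} [Fintype X] (σ : X → Bool) (u : X → ℝ) (g : Bool → ℝ) :
    ∑ x, u x * g (σ x) =
      (∑ x, if σ x then u x else 0) * g true + (∑ x, if σ x then 0 else u x) * g false := by
  rw [Finset.sum_mul, Finset.sum_mul, ← Finset.sum_add_distrib]
  refine Finset.sum_congr rfl fun x _ => ?_
  cases σ x <;> simp

lemma abs_sub_one_pow_three_le_of_convex {a b w w' : ℝ} (ha : 0 ≤ a) (hb : 0 ≤ b)
    (hab : 0 < a + b) :
    |(a * w + b * w') / (a + b) - 1| ^ 3 ≤ |w - 1| ^ 3 + |w' - 1| ^ 3 := by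
  have h : |(a * w + b * w') / (a + b) - 1| ≤ max |w - 1| |w' - 1| := by
    have : (a * w + b * w') / (a + b) - 1 = (a * (w - 1) + b * (w' - 1)) / (a + b) := by
      field_simp; ring
    rw [this, abs_div, abs_of_pos hab, div_le_iff₀ hab]
    calc _ ≤ |a * (w - 1)| + |b * (w' - 1)| := abs_add_le _ _
      _ = a * |w - 1| + b * |w' - 1| := by rw [abs_mul, abs_mul, abs_of_nonneg ha, abs_of_nonneg hb]
      _ ≤ a * max |w - 1| |w' - 1| + b * max |w - 1| |w' - 1| := by
        gcongr
        exacts [le_max_left _ _, le_max_right _ _]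
      _ = _ := by ring
  refine (pow_le_pow_left₀ (abs_nonneg _) h 3).trans ?_
  have h1 := pow_nonneg (abs_nonneg (w - 1)) 3
  have h2 := pow_nonneg (abs_nonneg (w' - 1)) 3
  rcases max_choice |w - 1| |w' - 1| with h | h <;> rw [h] <;> linarith

/-- Second-order expansion of the entropy of a weight vector reweighted by a two-valued likelihood
that is close to `1`. -/
lemma abs_weightEntropy_mul_comp_bool_add_le {X : Type*} [Fintype X] (σ : X → Bool) {u : X → ℝ}
    (hu : ∀ x, 0 ≤ u x) (hs : 0 < ∑ x, u x) {w : Bool → ℝ} (hw : ∀ b, 0 ≤ w b) :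
    |weightEntropy (fun x => u x * w (σ x)) -
        (∑ x, w (σ x) * negMulLog (u x) -
          (∑ x, u x * w (σ x)) / (∑ x, u x) * negMulLog (∑ x, u x)) +
        (∑ x, if σ x then u x else 0) * (∑ x, if σ x then 0 else u x) / (2 * ∑ x, u x) *
          (w true - w false) ^ 2| ≤
      30 * (∑ x, u x) * (|w true - 1| ^ 3 + |w false - 1| ^ 3) := by
  have hsum := sum_mul_comp_bool σ u
  have hs1 := hsum fun _ => 1
  simp only [mul_one] at hs1
  have hα : 0 ≤ ∑ x, if σ x then u x else 0 :=
    Finset.sum_nonneg fun x _ => by split_ifs; exacts [hu x, le_rfl]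
  have hβ : 0 ≤ ∑ x, if σ x then 0 else u x :=
    Finset.sum_nonneg fun x _ => by split_ifs; exacts [le_rfl, hu x]
  have hent : weightEntropy (fun x => u x * w (σ x)) =
      ∑ x, w (σ x) * negMulLog (u x) + ∑ x, u x * negMulLog (w (σ x)) -
        negMulLog (∑ x, u x * w (σ x)) := by
    simp only [weightEntropy, negMulLog_mul, Finset.sum_add_distrib]
  rw [hent, hsum fun b => negMulLog (w b), hsum w, hs1]
  rw [hs1] at hs
  generalize (∑ x, if σ x then u x else 0) = α at *
  generalize (∑ x, if σ x then 0 else u x) = β at *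
  set m := (α * w true + β * w false) / (α + β) with hm
  have hm' : α * w true + β * w false = (α + β) * m := by rw [hm]; field_simp
  have hm0 : 0 ≤ m := div_nonneg (add_nonneg (mul_nonneg hα (hw _)) (mul_nonneg hβ (hw _))) hs.le
  have e1 := abs_negMulLog_add_le (hw true)
  have e2 := abs_negMulLog_add_le (hw false)
  have e3 := abs_negMulLog_add_le hm0
  have e4 : |m - 1| ^ 3 ≤ |w true - 1| ^ 3 + |w false - 1| ^ 3 :=
    abs_sub_one_pow_three_le_of_convex hα hβ hs
  set r1 := negMulLog (w true) + (w true - 1) + (w true - 1) ^ 2 / 2 with hr1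
  set r2 := negMulLog (w false) + (w false - 1) + (w false - 1) ^ 2 / 2 with hr2
  set r3 := negMulLog m + (m - 1) + (m - 1) ^ 2 / 2 with hr3
  rw [hm', negMulLog_mul]
  have heq : ∑ x, w (σ x) * negMulLog (u x) +
        (α * negMulLog (w true) + β * negMulLog (w false)) -
        (m * negMulLog (α + β) + (α + β) * negMulLog m) -
      (∑ x, w (σ x) * negMulLog (u x) - m * negMulLog (α + β)) +
      α * β / (2 * (α + β)) * (w true - w false) ^ 2 =
      α * r1 + β * r2 - (α + β) * r3 := by
    rw [hr1, hr2, hr3, hm]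
    field_simp
    ring
  rw [heq]
  have hd1 := pow_nonneg (abs_nonneg (w true - 1)) 3
  have hd2 := pow_nonneg (abs_nonneg (w false - 1)) 3
  calc |α * r1 + β * r2 - (α + β) * r3| ≤ |α * r1| + |β * r2| + |(α + β) * r3| :=
        (abs_sub _ _).trans (by gcongr; exact abs_add_le _ _)
    _ = α * |r1| + β * |r2| + (α + β) * |r3| := by
        rw [abs_mul, abs_mul, abs_mul, abs_of_nonneg hα, abs_of_nonneg hβ, abs_of_pos hs]
    _ ≤ α * (15 * |w true - 1| ^ 3) + β * (15 * |w false - 1| ^ 3) +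
        (α + β) * (15 * (|w true - 1| ^ 3 + |w false - 1| ^ 3)) := by
        gcongr
        exact e3.trans (by gcongr)
    _ ≤ _ := by nlinarith [mul_nonneg hα hd2, mul_nonneg hβ hd1]

/-- A binary-input likelihood: a pair of probability densities with integrable squared difference
and integrable cubic deviations from `1`. -/
structure IsBinaryChannel {Ω : Type*} [MeasurableSpace Ω] (μ : Measure Ω) (w : Bool → Ω → ℝ) :
    Prop where
  isProbDensity : ∀ b, IsProbDensity μ (w b)
  integrable_sq : Integrable (fun ω => (w true ω - w false ω) ^ 2) μ
  integrable_cube : ∀ b, Integrable (fun ω => |w b ω - 1| ^ 3) μ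

lemma IsBinaryChannel.abs_integral_weightEntropy_sub_le {X Ω : Type*} [Fintype X]
    [MeasurableSpace Ω] {μ : Measure Ω} {w : Bool → Ω → ℝ} (hw : IsBinaryChannel μ w)
    (σ : X → Bool) {u : X → ℝ} (hu : ∀ x, 0 ≤ u x) (hs : 0 < ∑ x, u x) :
    |∫ ω, weightEntropy (fun x => u x * w (σ x) ω) ∂μ - (weightEntropy u -
        (∑ x, if σ x then u x else 0) * (∑ x, if σ x then 0 else u x) / (2 * ∑ x, u x) *
          ∫ ω, (w true ω - w false ω) ^ 2 ∂μ)| ≤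
      30 * (∑ x, u x) * (∫ ω, |w true ω - 1| ^ 3 ∂μ + ∫ ω, |w false ω - 1| ^ 3 ∂μ) := by
  set c := (∑ x, if σ x then u x else 0) * (∑ x, if σ x then 0 else u x) / (2 * ∑ x, u x)
  have hd := fun b => hw.isProbDensity b
  have i1 : Integrable (fun ω => weightEntropy fun x => u x * w (σ x) ω) μ :=
    integrable_weightEntropy (fun x => (hd _).measurable.const_mul _)
      (fun x => (hd _).integrable.const_mul _) fun x ω => mul_nonneg (hu x) ((hd _).nonneg ω)
  have i2 : Integrable (fun ω => ∑ x, w (σ x) ω * negMulLog (u x)) μ :=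
    integrable_finsetSum _ fun x _ => (hd _).integrable.mul_const _
  have i3 : Integrable (fun ω => (∑ x, u x * w (σ x) ω) / (∑ x, u x) * negMulLog (∑ x, u x)) μ :=
    ((integrable_finsetSum _ fun x _ => (hd _).integrable.const_mul _).div_const _).mul_const _
  have i4 : Integrable (fun ω => c * (w true ω - w false ω) ^ 2) μ := hw.integrable_sq.const_mul c
  have v2 : ∫ ω, ∑ x, w (σ x) ω * negMulLog (u x) ∂μ = ∑ x, negMulLog (u x) := by
    rw [integral_finsetSum _ fun x _ => (hd _).integrable.mul_const _]
    simp only [integral_mul_const, (hd _).integral_eq_one, one_mul]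
  have v3 : ∫ ω, (∑ x, u x * w (σ x) ω) / (∑ x, u x) * negMulLog (∑ x, u x) ∂μ =
      negMulLog (∑ x, u x) := by
    rw [integral_mul_const, integral_div,
      integral_finsetSum _ fun x _ => (hd _).integrable.const_mul _]
    simp only [integral_const_mul, (hd _).integral_eq_one, mul_one]
    rw [div_self hs.ne', one_mul]
  have hkey : ∫ ω, weightEntropy (fun x => u x * w (σ x) ω) ∂μ - (weightEntropy u -
        c * ∫ ω, (w true ω - w false ω) ^ 2 ∂μ) =
      ∫ ω, (weightEntropy (fun x => u x * w (σ x) ω) -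
        (∑ x, w (σ x) ω * negMulLog (u x) -
          (∑ x, u x * w (σ x) ω) / (∑ x, u x) * negMulLog (∑ x, u x)) +
        c * (w true ω - w false ω) ^ 2) ∂μ := by
    have i23 : Integrable (fun ω => ∑ x, w (σ x) ω * negMulLog (u x) -
        (∑ x, u x * w (σ x) ω) / (∑ x, u x) * negMulLog (∑ x, u x)) μ := i2.sub i3
    have i123 : Integrable (fun ω => weightEntropy (fun x => u x * w (σ x) ω) -
        (∑ x, w (σ x) ω * negMulLog (u x) -
          (∑ x, u x * w (σ x) ω) / (∑ x, u x) * negMulLog (∑ x, u x))) μ := i1.sub i23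
    rw [integral_add i123 i4, integral_sub i1 i23, integral_sub i2 i3, v2, v3,
      integral_const_mul]
    simp only [weightEntropy]
    ring
  have i5 := (hw.integrable_cube true).add (hw.integrable_cube false)
  rw [hkey, ← integral_add (hw.integrable_cube true) (hw.integrable_cube false),
    ← integral_const_mul, ← Real.norm_eq_abs]
  refine norm_integral_le_of_norm_le (i5.const_mul _) (Filter.Eventually.of_forall fun ω => ?_)
  exact abs_weightEntropy_mul_comp_bool_add_le σ hu hs (w := fun b => w b ω)
    fun b => (hd b).nonneg ω

/-- Two binary channels whose likelihoods have nearly the same separation and small cubic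
deviations from `1` are nearly interchangeable. -/
lemma IsBinaryChannel.abs_integral_weightEntropy_sub_integral_le {X Ω : Type*} [Fintype X]
    [MeasurableSpace Ω] {μ : Measure Ω} {w w' : Bool → Ω → ℝ} (hw : IsBinaryChannel μ w)
    (hw' : IsBinaryChannel μ w') (σ : X → Bool) {δ r r' : ℝ}
    (hδ : |∫ ω, (w true ω - w false ω) ^ 2 ∂μ - ∫ ω, (w' true ω - w' false ω) ^ 2 ∂μ| ≤ δ)
    (hr : ∫ ω, |w true ω - 1| ^ 3 ∂μ + ∫ ω, |w false ω - 1| ^ 3 ∂μ ≤ r)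
    (hr' : ∫ ω, |w' true ω - 1| ^ 3 ∂μ + ∫ ω, |w' false ω - 1| ^ 3 ∂μ ≤ r')
    (u : X → ℝ) (hu : ∀ x, 0 ≤ u x) :
    |∫ ω, weightEntropy (fun x => u x * w (σ x) ω) ∂μ -
        ∫ ω, weightEntropy (fun x => u x * w' (σ x) ω) ∂μ| ≤
      (δ / 8 + 30 * (r + r')) * ∑ x, u x := by
  rcases (Finset.sum_nonneg fun x _ => hu x : 0 ≤ ∑ x, u x).eq_or_lt with h0 | hs
  · have : ∀ x, u x = 0 := fun x =>
      (Finset.sum_eq_zero_iff_of_nonneg fun x _ => hu x).mp h0.symm x (Finset.mem_univ x)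
    simp [this]
  have h1 := hw.abs_integral_weightEntropy_sub_le σ hu hs
  have h2 := hw'.abs_integral_weightEntropy_sub_le σ hu hs
  have hs1 := sum_mul_comp_bool σ u fun _ => 1
  simp only [mul_one] at hs1
  have hα : 0 ≤ ∑ x, if σ x then u x else 0 :=
    Finset.sum_nonneg fun x _ => by split_ifs; exacts [hu x, le_rfl]
  have hβ : 0 ≤ ∑ x, if σ x then 0 else u x :=
    Finset.sum_nonneg fun x _ => by split_ifs; exacts [le_rfl, hu x]
  set c := (∑ x, if σ x then u x else 0) * (∑ x, if σ x then 0 else u x) / (2 * ∑ x, u x) with hc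
  have hc0 : 0 ≤ c := by positivity
  have hc8 : c ≤ (∑ x, u x) / 8 := by
    rw [hc, div_le_iff₀ (by positivity), hs1]
    nlinarith [sq_nonneg ((∑ x, if σ x then u x else 0) - ∑ x, if σ x then 0 else u x)]
  have h3 : 30 * (∑ x, u x) * (∫ ω, |w true ω - 1| ^ 3 ∂μ + ∫ ω, |w false ω - 1| ^ 3 ∂μ) ≤
      30 * (∑ x, u x) * r := by gcongr
  have h4 : 30 * (∑ x, u x) * (∫ ω, |w' true ω - 1| ^ 3 ∂μ + ∫ ω, |w' false ω - 1| ^ 3 ∂μ) ≤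
      30 * (∑ x, u x) * r' := by gcongr
  set Q := ∫ ω, (w true ω - w false ω) ^ 2 ∂μ
  set Q' := ∫ ω, (w' true ω - w' false ω) ^ 2 ∂μ
  have h5 : |c * (Q - Q')| ≤ (∑ x, u x) / 8 * δ := by
    rw [abs_mul, abs_of_nonneg hc0]
    gcongr
  rw [abs_le] at h1 h2 h5 ⊢
  constructor <;> nlinarith

lemma IsBinaryChannel.comp_measurePreserving {Ω Ω' : Type*} [MeasurableSpace Ω]
    [MeasurableSpace Ω'] {μ : Measure Ω} {ν : Measure Ω'} {w : Bool → Ω' → ℝ}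
    (hw : IsBinaryChannel ν w) {f : Ω → Ω'} (hf : MeasurePreserving f μ ν) :
    IsBinaryChannel μ fun b ω => w b (f ω) where
  isProbDensity b :=
    { measurable := (hw.isProbDensity b).measurable.comp hf.measurable
      nonneg := fun ω => (hw.isProbDensity b).nonneg _
      integrable := hf.integrable_comp_of_integrable (hw.isProbDensity b).integrable
      integral_eq_one := by
        rw [← (hw.isProbDensity b).integral_eq_one, ← hf.map_eq]
        refine (integral_map hf.measurable.aemeasurable ?_).symm
        rw [hf.map_eq]
        exact (hw.isProbDensity b).integrable.aestronglyMeasurable }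
  integrable_sq := hf.integrable_comp_of_integrable hw.integrable_sq
  integrable_cube b := hf.integrable_comp_of_integrable (hw.integrable_cube b)

lemma _root_.MeasureTheory.MeasurePreserving.integral_comp_of_measurable {Ω Ω' : Type*}
    [MeasurableSpace Ω] [MeasurableSpace Ω'] {μ : Measure Ω} {ν : Measure Ω'} {f : Ω → Ω'}
    (hf : MeasurePreserving f μ ν) {g : Ω' → ℝ} (hg : Measurable g) :
    ∫ ω, g (f ω) ∂μ = ∫ ω, g ω ∂ν := by
  rw [← hf.map_eq, integral_map hf.measurable.aemeasurable hg.aestronglyMeasurable]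

open ProbabilityTheory

/-- Likelihood ratio of `N(c, 1)` with respect to `N(0, 1)`. -/
noncomputable def gaussRatio (c t : ℝ) : ℝ := exp (c * t - c ^ 2 / 2)

lemma gaussRatio_pos (c t : ℝ) : 0 < gaussRatio c t := exp_pos _

lemma measurable_gaussRatio (c : ℝ) : Measurable (gaussRatio c) := by
  unfold gaussRatio; fun_prop

lemma integrable_gaussRatio_pow (c : ℝ) (k : ℕ) :
    Integrable (fun t => gaussRatio c t ^ k) (gaussianReal 0 1) := by
  have h : (fun t => gaussRatio c t ^ k) = fun t => exp (-(k * c ^ 2 / 2)) * exp (k * c * t) := by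
    funext t
    rw [gaussRatio, ← exp_nat_mul, ← exp_add]
    ring_nf
  rw [h]
  exact (integrable_exp_mul_gaussianReal _).const_mul _

lemma integral_gaussRatio_pow (c : ℝ) (k : ℕ) :
    ∫ t, gaussRatio c t ^ k ∂(gaussianReal 0 1) = exp ((k ^ 2 - k) / 2 * c ^ 2) := by
  have h : (fun t => gaussRatio c t ^ k) = fun t => exp (-(k * c ^ 2 / 2)) * exp (k * c * t) := by
    funext t
    rw [gaussRatio, ← exp_nat_mul, ← exp_add]
    ring_nf
  have hm := congrFun (mgf_id_gaussianReal (μ := 0) (v := 1)) (k * c)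
  simp only [mgf, id] at hm
  rw [h, integral_const_mul, hm, ← exp_add]
  congr 1
  push_cast
  ring

lemma isProbDensity_gaussRatio (c : ℝ) : IsProbDensity (gaussianReal 0 1) (gaussRatio c) where
  measurable := measurable_gaussRatio c
  nonneg t := (gaussRatio_pos c t).le
  integrable := by simpa using integrable_gaussRatio_pow c 1
  integral_eq_one := by simpa using integral_gaussRatio_pow c 1

lemma integrable_gaussRatio_sub_one_pow_four (c : ℝ) :
    Integrable (fun t => (gaussRatio c t - 1) ^ 4) (gaussianReal 0 1) := by
  have h : (fun t => (gaussRatio c t - 1) ^ 4) = fun t => gaussRatio c t ^ 4 -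
      4 * gaussRatio c t ^ 3 + 6 * gaussRatio c t ^ 2 - 4 * gaussRatio c t ^ 1 + 1 := by
    funext t; ring
  rw [h]
  have i := integrable_gaussRatio_pow c
  exact ((((i 4).sub ((i 3).const_mul 4)).add ((i 2).const_mul 6)).sub ((i 1).const_mul 4)).add
    (integrable_const 1)

lemma integrable_gaussRatio_sub_one_sq (c : ℝ) :
    Integrable (fun t => (gaussRatio c t - 1) ^ 2) (gaussianReal 0 1) := by
  have h : (fun t => (gaussRatio c t - 1) ^ 2) = fun t => gaussRatio c t ^ 2 -
      2 * gaussRatio c t ^ 1 + 1 := by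
    funext t; ring
  rw [h]
  have i := integrable_gaussRatio_pow c
  exact ((i 2).sub ((i 1).const_mul 2)).add (integrable_const 1)

lemma integral_gaussRatio_sub_one_sq (c : ℝ) :
    ∫ t, (gaussRatio c t - 1) ^ 2 ∂(gaussianReal 0 1) = exp (c ^ 2) - 1 := by
  have h : ∀ t, (gaussRatio c t - 1) ^ 2 = gaussRatio c t ^ 2 - 2 * gaussRatio c t ^ 1 + 1 := by
    intro t; ring
  simp only [h]
  have i := integrable_gaussRatio_pow c
  rw [integral_add (by fun_prop) (by fun_prop), integral_sub (by fun_prop) (by fun_prop)]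
  simp only [integral_const_mul, integral_gaussRatio_pow]
  norm_num
  ring

lemma integral_gaussRatio_sub_one_pow_four (c : ℝ) :
    ∫ t, (gaussRatio c t - 1) ^ 4 ∂(gaussianReal 0 1) =
      exp (6 * c ^ 2) - 4 * exp (3 * c ^ 2) + 6 * exp (c ^ 2) - 3 := by
  have h : ∀ t, (gaussRatio c t - 1) ^ 4 = gaussRatio c t ^ 4 -
      4 * gaussRatio c t ^ 3 + 6 * gaussRatio c t ^ 2 - 4 * gaussRatio c t ^ 1 + 1 := by
    intro t; ring
  simp only [h]
  have i4 := integrable_gaussRatio_pow c 4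
  have i3 := (integrable_gaussRatio_pow c 3).const_mul 4
  have i2 := (integrable_gaussRatio_pow c 2).const_mul 6
  have i1 := (integrable_gaussRatio_pow c 1).const_mul 4
  rw [integral_add (by fun_prop) (by fun_prop), integral_sub (by fun_prop) (by fun_prop),
    integral_add (by fun_prop) (by fun_prop), integral_sub (by fun_prop) (by fun_prop)]
  simp only [integral_const_mul, integral_gaussRatio_pow]
  norm_num
  ring

lemma abs_pow_three_le {a : ℝ} (ha : 0 < a) (d : ℝ) :
    |d| ^ 3 ≤ a / 2 * d ^ 2 + 1 / (2 * a) * d ^ 4 := by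
  have h : a / 2 * d ^ 2 + 1 / (2 * a) * d ^ 4 - |d| ^ 3 = |d| ^ 2 * (a - |d|) ^ 2 / (2 * a) := by
    rw [← sq_abs d, show d ^ 4 = |d| ^ 4 from (Even.pow_abs (by decide) d).symm]
    field_simp
    ring
  have : 0 ≤ |d| ^ 2 * (a - |d|) ^ 2 / (2 * a) := by positivity
  linarith

lemma integrable_gaussRatio_sub_one_cube (c : ℝ) :
    Integrable (fun t => |gaussRatio c t - 1| ^ 3) (gaussianReal 0 1) := by
  refine Integrable.mono' (((integrable_gaussRatio_sub_one_sq c).const_mul (1 / 2)).add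
    ((integrable_gaussRatio_sub_one_pow_four c).const_mul (1 / (2 * 1)))) ?_
    (Filter.Eventually.of_forall fun t => ?_)
  · have := measurable_gaussRatio c
    exact Measurable.aestronglyMeasurable (by fun_prop)
  · rw [norm_eq_abs, abs_of_nonneg (by positivity)]
    exact abs_pow_three_le one_pos _

lemma integral_gaussRatio_sub_one_cube_le {a c : ℝ} (ha : 0 < a) (hc : c ^ 2 = a ^ 2)
    (ha' : a ^ 2 ≤ 1 / 6) :
    ∫ t, |gaussRatio c t - 1| ^ 3 ∂(gaussianReal 0 1) ≤ 22 * a ^ 3 := by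
  have i2 := (integrable_gaussRatio_sub_one_sq c).const_mul (a / 2)
  have i4 := (integrable_gaussRatio_sub_one_pow_four c).const_mul (1 / (2 * a))
  have h := integral_mono (integrable_gaussRatio_sub_one_cube c) (i2.add i4)
    fun t => abs_pow_three_le ha _
  simp only [Pi.add_apply] at h
  rw [integral_add i2 i4, integral_const_mul, integral_const_mul, integral_gaussRatio_sub_one_sq,
    integral_gaussRatio_sub_one_pow_four, hc] at h
  refine h.trans ?_
  have ha2 : 0 < a ^ 2 := by positivity
  have e1 := (abs_le.mp (abs_exp_sub_one_sub_id_le (x := a ^ 2) (by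
    rw [abs_of_pos ha2]; linarith))).2
  have e6 := (abs_le.mp (abs_exp_sub_one_sub_id_le (x := 6 * a ^ 2) (by
    rw [abs_of_pos (by linarith)]; linarith))).2
  have e3 := add_one_le_exp (3 * a ^ 2)
  have q4 : exp (6 * a ^ 2) - 4 * exp (3 * a ^ 2) + 6 * exp (a ^ 2) - 3 ≤ 42 * a ^ 4 := by
    nlinarith
  have q2 : exp (a ^ 2) - 1 ≤ 2 * a ^ 2 := by nlinarith
  calc _ ≤ a / 2 * (2 * a ^ 2) + 1 / (2 * a) * (42 * a ^ 4) := by gcongr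
    _ = 22 * a ^ 3 := by field_simp; ring

/-- The channel sending a sign to its rescaling by `a` plus standard Gaussian noise. -/
lemma isBinaryChannel_gaussRatio (a : ℝ) :
    IsBinaryChannel (gaussianReal 0 1) fun b => gaussRatio (a * chi b) where
  isProbDensity b := isProbDensity_gaussRatio _
  integrable_sq := by
    have h : (fun t => (gaussRatio (a * chi true) t - gaussRatio (a * chi false) t) ^ 2) =
        fun t => gaussRatio (a * chi true) t ^ 2 + gaussRatio (a * chi false) t ^ 2 -
          2 * exp (-a ^ 2) := by
      funext t
      have : gaussRatio (a * chi true) t * gaussRatio (a * chi false) t = exp (-a ^ 2) := by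
        rw [gaussRatio, gaussRatio, ← exp_add]
        simp only [chi]
        norm_num
        ring
      rw [← this]; ring
    rw [h]
    exact ((integrable_gaussRatio_pow _ 2).add (integrable_gaussRatio_pow _ 2)).sub
      (integrable_const _)
  integrable_cube b := integrable_gaussRatio_sub_one_cube _

lemma integral_gaussRatio_sub_sq (a : ℝ) :
    ∫ t, (gaussRatio (a * chi true) t - gaussRatio (a * chi false) t) ^ 2 ∂(gaussianReal 0 1) =
      2 * exp (a ^ 2) - 2 * exp (-a ^ 2) := by
  have h : ∀ t, (gaussRatio (a * chi true) t - gaussRatio (a * chi false) t) ^ 2 =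
      gaussRatio (a * chi true) t ^ 2 + gaussRatio (a * chi false) t ^ 2 -
        2 * exp (-a ^ 2) := by
    intro t
    have : gaussRatio (a * chi true) t * gaussRatio (a * chi false) t = exp (-a ^ 2) := by
      rw [gaussRatio, gaussRatio, ← exp_add]
      simp only [chi]
      norm_num
      ring
    rw [← this]; ring
  simp only [h]
  have i1 := integrable_gaussRatio_pow (a * chi true) 2
  have i2 := integrable_gaussRatio_pow (a * chi false) 2
  rw [integral_sub (by fun_prop) (by fun_prop), integral_add i1 i2]
  simp only [integral_gaussRatio_pow, chi]
  norm_num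
  ring

lemma abs_integral_gaussRatio_sub_sq_sub_le {a : ℝ} (ha : a ^ 2 ≤ 1) :
    |∫ t, (gaussRatio (a * chi true) t - gaussRatio (a * chi false) t) ^ 2 ∂(gaussianReal 0 1) -
      4 * a ^ 2| ≤ 4 * a ^ 4 := by
  rw [integral_gaussRatio_sub_sq]
  have e1 := abs_exp_sub_one_sub_id_le (x := a ^ 2) (by rwa [abs_of_nonneg (sq_nonneg a)])
  have e2 := abs_exp_sub_one_sub_id_le (x := -a ^ 2) (by
    rwa [abs_neg, abs_of_nonneg (sq_nonneg a)])
  rw [abs_le] at e1 e2 ⊢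
  constructor <;> nlinarith

open unitInterval

/-- Probability that a pair of vertices with equal (`b = true`) or different (`b = false`) labels is
joined (`g = true`) or not joined (`g = false`). -/
noncomputable def edgeProb (p q : ℝ) (b g : Bool) : ℝ :=
  if g then (if b then p else q) else 1 - (if b then p else q)

lemma edgeProb_nonneg {p q : ℝ} (hp : p ∈ Set.Icc (0 : ℝ) 1) (hq : q ∈ Set.Icc (0 : ℝ) 1)
    (b g : Bool) : 0 ≤ edgeProb p q b g := by
  obtain ⟨hp0, hp1⟩ := hp
  obtain ⟨hq0, hq1⟩ := hq
  cases b <;> cases g <;> simp [edgeProb] <;> linarith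

lemma sum_edgeProb (p q : ℝ) (b : Bool) : ∑ g, edgeProb p q b g = 1 := by
  simp [edgeProb]

/-- Likelihood ratio of an edge observation with respect to the Bernoulli law of parameter `r`. -/
noncomputable def edgeRatio (p q r : ℝ) (b g : Bool) : ℝ :=
  edgeProb p q b g / (if g then r else 1 - r)

lemma integral_bernoulliMeasure_bool (r : I) (f : Bool → ℝ) :
    ∫ g, f g ∂(bernoulliMeasure true false r) = r * f true + (1 - r) * f false := by
  rw [integral_fintype .of_finite]
  simp

lemma isBinaryChannel_edgeRatio {p q : ℝ} (hp : p ∈ Set.Icc (0 : ℝ) 1)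
    (hq : q ∈ Set.Icc (0 : ℝ) 1) {r : I} (hr0 : 0 < (r : ℝ)) (hr1 : (r : ℝ) < 1) :
    IsBinaryChannel (bernoulliMeasure true false r) (edgeRatio p q r) where
  isProbDensity b :=
    { measurable := .of_discrete
      nonneg := fun g => div_nonneg (edgeProb_nonneg hp hq b g) (by split_ifs <;> linarith)
      integrable := .of_finite
      integral_eq_one := by
        rw [integral_bernoulliMeasure_bool]
        have : 1 - (r : ℝ) ≠ 0 := by linarith
        simp only [edgeRatio, edgeProb]
        simp
        field_simp
        ring }
  integrable_sq := .of_finite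
  integrable_cube b := .of_finite

lemma integral_edgeRatio_sub_sq {p q : ℝ} {r : I} (hr0 : 0 < (r : ℝ)) (hr1 : (r : ℝ) < 1) :
    ∫ g, (edgeRatio p q r true g - edgeRatio p q r false g) ^ 2
        ∂(bernoulliMeasure true false r) = (p - q) ^ 2 / (r * (1 - r)) := by
  rw [integral_bernoulliMeasure_bool]
  have : 1 - (r : ℝ) ≠ 0 := by linarith
  simp only [edgeRatio, edgeProb]
  simp
  field_simp
  ring

lemma integral_edgeRatio_sub_one_cube_add_le {p q : ℝ} {r : I} (hr : (r : ℝ) = (p + q) / 2)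
    (hr0 : 0 < (r : ℝ)) (hr1 : (r : ℝ) < 1) :
    ∫ g, |edgeRatio p q r true g - 1| ^ 3 ∂(bernoulliMeasure true false r) +
        ∫ g, |edgeRatio p q r false g - 1| ^ 3 ∂(bernoulliMeasure true false r) ≤
      |p - q| ^ 3 / (4 * (r * (1 - r)) ^ 2) := by
  rw [integral_bernoulliMeasure_bool, integral_bernoulliMeasure_bool]
  have h1 : 0 < 1 - (r : ℝ) := by linarith
  have e1 : edgeRatio p q r true true - 1 = (p - q) / (2 * r) := by
    simp only [edgeRatio, edgeProb]; simp; field_simp; linarith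
  have e2 : edgeRatio p q r true false - 1 = -((p - q) / (2 * (1 - r))) := by
    simp only [edgeRatio, edgeProb]; simp; field_simp; linarith
  have e3 : edgeRatio p q r false true - 1 = -((p - q) / (2 * r)) := by
    simp only [edgeRatio, edgeProb]; simp; field_simp; linarith
  have e4 : edgeRatio p q r false false - 1 = (p - q) / (2 * (1 - r)) := by
    simp only [edgeRatio, edgeProb]; simp; field_simp; linarith
  rw [e1, e2, e3, e4, abs_neg, abs_neg, abs_div, abs_div, abs_of_pos (by linarith : 0 < 2 * (r:ℝ)),
    abs_of_pos (by linarith : 0 < 2 * (1 - (r : ℝ)))]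
  have hd := abs_nonneg (p - q)
  generalize |p - q| = d at *
  have h : d ^ 3 / (4 * (r * (1 - r)) ^ 2) -
      (r * (d / (2 * r)) ^ 3 + (1 - r) * (d / (2 * (1 - r))) ^ 3 +
        (r * (d / (2 * r)) ^ 3 + (1 - r) * (d / (2 * (1 - r))) ^ 3)) =
      d ^ 3 * (2 * (r * (1 - r))) / (4 * (r * (1 - r)) ^ 2) := by
    field_simp
    ring
  have : 0 ≤ d ^ 3 * (2 * (r * (1 - r))) / (4 * (r * (1 - r)) ^ 2) := by positivity
  linarith

section Observation

variable {X Ω : Type*} [Fintype X] [MeasurableSpace Ω] {μ : Measure Ω} {L : X → Ω → ℝ} {c : ℝ}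

lemma sum_integral_mul_log_eq (hL : ∀ x, IsProbDensity μ (L x)) (hc : 0 < c)
    (hcX : Fintype.card X * c = 1) :
    c * ∑ x, ∫ ω, L x ω * log (L x ω / ∑ x', c * L x' ω) ∂μ =
      -log c - ∫ ω, weightEntropy (fun x => c * L x ω) ∂μ := by
  have h0 : ∀ x ω, 0 ≤ c * L x ω := fun x ω => mul_nonneg hc.le ((hL x).nonneg ω)
  have hv : ∀ x, Measurable fun ω => c * L x ω := fun x => (hL x).measurable.const_mul c
  have hterm : ∀ x ω, c * (L x ω * log (L x ω / ∑ x', c * L x' ω)) =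
      -log c * (c * L x ω) - c * L x ω * (log (∑ x', c * L x' ω) - log (c * L x ω)) := by
    intro x ω
    rcases ((hL x).nonneg ω).eq_or_lt with h | h
    · simp [← h]
    · have hS : 0 < ∑ x', c * L x' ω := (mul_pos hc h).trans_le
        (Finset.single_le_sum (fun y _ => h0 y ω) (Finset.mem_univ x))
      rw [log_div h.ne' hS.ne', log_mul hc.ne' h.ne']
      ring
  have hent := integrable_weightEntropy hv (fun x => (hL x).integrable.const_mul c) h0
  have hi : ∀ x, Integrable
      (fun ω => c * L x ω * (log (∑ x', c * L x' ω) - log (c * L x ω))) μ := by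
    intro x
    refine hent.mono' ?_ (Filter.Eventually.of_forall fun ω => ?_)
    · exact ((hv x).mul ((measurable_log.comp (Finset.measurable_sum _ fun x _ => hv x)).sub
        (measurable_log.comp (hv x)))).aestronglyMeasurable
    · rw [norm_eq_abs, abs_of_nonneg (mul_log_sub_log_nonneg (h0 · ω) x), weightEntropy_eq_sum]
      exact Finset.single_le_sum (f := fun x => c * L x ω * (log (∑ x', c * L x' ω) -
        log (c * L x ω))) (fun y _ => mul_log_sub_log_nonneg (h0 · ω) y) (Finset.mem_univ x)
  rw [Finset.mul_sum]
  simp only [weightEntropy_eq_sum]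
  rw [integral_finsetSum _ fun x _ => hi x]
  have hx : ∀ x, c * ∫ ω, L x ω * log (L x ω / ∑ x', c * L x' ω) ∂μ =
      -log c * c - ∫ ω, c * L x ω * (log (∑ x', c * L x' ω) - log (c * L x ω)) ∂μ := by
    intro x
    rw [← integral_const_mul]
    simp only [hterm]
    rw [integral_sub (((hL x).integrable.const_mul c).const_mul _) (hi x)]
    simp only [integral_const_mul, (hL x).integral_eq_one, mul_one]
  simp only [hx, Finset.sum_sub_distrib, Finset.sum_const, Finset.card_univ, nsmul_eq_mul]
  congr 1
  calc _ = -log c * (Fintype.card X * c) := by ring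
    _ = _ := by rw [hcX, mul_one]

lemma integral_weightEntropy_nonneg (hL : ∀ x, IsProbDensity μ (L x)) (hc : 0 < c) :
    0 ≤ ∫ ω, weightEntropy (fun x => c * L x ω) ∂μ :=
  integral_nonneg fun ω => weightEntropy_nonneg fun x => mul_nonneg hc.le ((hL x).nonneg ω)

lemma integral_weightEntropy_le (hL : ∀ x, IsProbDensity μ (L x)) (hc : 0 < c)
    (hcX : Fintype.card X * c = 1) :
    ∫ ω, weightEntropy (fun x => c * L x ω) ∂μ ≤ log (Fintype.card X) := by
  have h0 : ∀ x ω, 0 ≤ c * L x ω := fun x ω => mul_nonneg hc.le ((hL x).nonneg ω)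
  have hi : ∀ x, Integrable (fun ω => c * L x ω) μ := fun x => (hL x).integrable.const_mul c
  calc _ ≤ ∫ ω, (∑ x, c * L x ω) * log (Fintype.card X) ∂μ :=
        integral_mono (integrable_weightEntropy (fun x => (hL x).measurable.const_mul c) hi h0)
          ((integrable_finsetSum _ fun x _ => hi x).mul_const _)
          fun ω => weightEntropy_le fun x => h0 x ω
    _ = _ := by
        rw [integral_mul_const, integral_finsetSum _ fun x _ => hi x]
        simp only [integral_const_mul, (hL _).integral_eq_one, mul_one, Finset.sum_const,
          Finset.card_univ, nsmul_eq_mul, hcX, one_mul]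

end Observation

lemma IsProbDensity.pi_withDensity {ι Ω : Type*} [Fintype ι] [MeasurableSpace Ω] {μ : Measure Ω}
    [IsProbabilityMeasure μ] {w : ι → Ω → ℝ} (hw : ∀ i, IsProbDensity μ (w i)) :
    Measure.pi (fun i => μ.withDensity fun t => ENNReal.ofReal (w i t)) =
      (Measure.pi fun _ : ι => μ).withDensity fun y => ENNReal.ofReal (∏ i, w i (y i)) := by
  have : ∀ i, IsFiniteMeasure (μ.withDensity fun t => ENNReal.ofReal (w i t)) := fun i =>
    isFiniteMeasure_withDensity_ofReal (hw i).integrable.2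
  refine Measure.pi_eq fun s hs => ?_
  have hi : ∀ i, Integrable (w i) (μ.restrict (s i)) := fun i => (hw i).integrable.restrict
  have h0 : ∀ i t, 0 ≤ w i t := fun i => (hw i).nonneg
  rw [withDensity_apply _ (MeasurableSet.univ_pi hs), Measure.restrict_pi_pi,
    ← ofReal_integral_eq_lintegral_ofReal (Integrable.fintype_prod hi)
      (Filter.Eventually.of_forall fun y => Finset.prod_nonneg fun i _ => h0 i _),
    integral_fintype_prod_eq_prod,
    ENNReal.ofReal_prod_of_nonneg fun i _ => integral_nonneg (h0 i)]
  refine Finset.prod_congr rfl fun i _ => ?_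
  rw [withDensity_apply _ (hs i), ofReal_integral_eq_lintegral_ofReal (hi i)
    (Filter.Eventually.of_forall (h0 i))]

lemma gaussianReal_eq_withDensity_gaussRatio (c : ℝ) :
    gaussianReal c 1 = (gaussianReal 0 1).withDensity fun t => ENNReal.ofReal (gaussRatio c t) := by
  rw [gaussianReal_of_var_ne_zero c one_ne_zero, gaussianReal_of_var_ne_zero 0 one_ne_zero,
    ← withDensity_mul _ (measurable_gaussianPDF 0 1) (measurable_gaussRatio c).ennreal_ofReal]
  congr 1
  funext t
  rw [Pi.mul_apply, gaussianPDF, gaussianPDF, ← ENNReal.ofReal_mul (gaussianPDFReal_nonneg 0 1 t),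
    gaussianPDFReal, gaussianPDFReal, gaussRatio, mul_assoc _ (exp _) (exp _), ← exp_add]
  congr 3
  simp
  ring

lemma integral_comp_add_pi_gaussianReal {ι : Type*} [Fintype ι] (c : ι → ℝ) {F : (ι → ℝ) → ℝ}
    (hF : Measurable F) :
    ∫ z, F (fun e => z e + c e) ∂(Measure.pi fun _ : ι => gaussianReal 0 1) =
      ∫ z, (∏ e, gaussRatio (c e) (z e)) * F z ∂(Measure.pi fun _ : ι => gaussianReal 0 1) := by
  have hpres : MeasurePreserving (fun z : ι → ℝ => fun e => z e + c e)
      (Measure.pi fun _ : ι => gaussianReal 0 1) (Measure.pi fun e => gaussianReal (c e) 1) :=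
    measurePreserving_pi _ _ fun e =>
      ⟨measurable_add_const (c e), by rw [gaussianReal_map_add_const, zero_add]⟩
  have hd := IsProbDensity.pi fun e => isProbDensity_gaussRatio (c e)
  rw [hpres.integral_comp_of_measurable hF]
  simp only [gaussianReal_eq_withDensity_gaussRatio (c _)]
  rw [IsProbDensity.pi_withDensity fun e => isProbDensity_gaussRatio (c e),
    integral_withDensity_eq_integral_toReal_smul hd.measurable.ennreal_ofReal
      (Filter.Eventually.of_forall fun _ => ENNReal.ofReal_lt_top)]
  simp only [ENNReal.toReal_ofReal (hd.nonneg _), smul_eq_mul]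

/-- Whether the endpoints of the pair `e` carry the same label. -/
noncomputable def sameLabel {n : ℕ} (x : Fin n → Bool) (e : VPair n) : Bool :=
  decide (x e.1.1 = x e.1.2)

lemma chi_mul_chi {n : ℕ} (x : Fin n → Bool) (e : VPair n) :
    chi (x e.1.1) * chi (x e.1.2) = chi (sameLabel x e) := by
  unfold sameLabel chi
  cases x e.1.1 <;> cases x e.1.2 <;> simp

lemma card_labels_mul (n : ℕ) : (Fintype.card (Fin n → Bool) : ℝ) * (1 / 2) ^ n = 1 := by
  rw [Fintype.card_fun, Fintype.card_bool, Fintype.card_fin, Nat.cast_pow, ← mul_pow]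
  norm_num

lemma gaussDensity_eq (n : ℕ) (lam : ℝ) (x : Fin n → Bool) (y : VPair n → ℝ) :
    gaussDensity n lam x y = (∏ e, exp (-y e ^ 2 / 2) / √(2 * π)) *
      ∏ e, gaussRatio (√(lam / n) * chi (sameLabel x e)) (y e) := by
  rw [gaussDensity, ← Finset.prod_mul_distrib]
  refine Finset.prod_congr rfl fun e _ => ?_
  rw [chi_mul_chi, gaussRatio, div_mul_eq_mul_div, ← exp_add]
  ring_nf

/-- The likelihood ratios of the label vectors, relative to pure noise, form the densities of the
observation. -/
lemma isProbDensity_prod_gaussRatio (n : ℕ) (a : ℝ) (x : Fin n → Bool) :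
    IsProbDensity (Measure.pi fun _ : VPair n => gaussianReal 0 1)
      fun y => ∏ e, gaussRatio (a * chi (sameLabel x e)) (y e) :=
  IsProbDensity.pi fun e => isProbDensity_gaussRatio (a * chi (sameLabel x e))

lemma miGauss_eq (n : ℕ) (lam : ℝ) :
    miGauss n lam = -log ((1 / 2) ^ n) -
      ∫ y, weightEntropy (fun x : Fin n → Bool =>
        (1 / 2) ^ n * ∏ e, gaussRatio (√(lam / n) * chi (sameLabel x e)) (y e))
        ∂(Measure.pi fun _ : VPair n => gaussianReal 0 1) := by
  have hL := isProbDensity_prod_gaussRatio n (√(lam / n))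
  rw [← sum_integral_mul_log_eq hL (by positivity) (card_labels_mul n), miGauss]
  congr 1
  refine Finset.sum_congr rfl fun x _ => ?_
  rw [← integral_comp_add_pi_gaussianReal (fun e => √(lam / n) * chi (sameLabel x e))]
  · congr 1
    funext z
    simp only [chi_mul_chi, gaussDensity_eq, ← Finset.mul_sum]
    rw [mul_left_comm, mul_div_mul_left _ _ (ne_of_gt (Finset.prod_pos fun e _ => by positivity))]
  · exact measurable_log.comp ((hL x).measurable.div
      (Finset.measurable_sum _ fun x _ => (hL x).measurable.const_mul _))

lemma isProbDensity_prod_edgeProb {p q : ℝ} (hp : p ∈ Set.Icc (0 : ℝ) 1)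
    (hq : q ∈ Set.Icc (0 : ℝ) 1) (n : ℕ) (x : Fin n → Bool) :
    IsProbDensity Measure.count
      fun g : VPair n → Bool => ∏ e, edgeProb p q (sameLabel x e) (g e) where
  measurable := .of_discrete
  nonneg g := Finset.prod_nonneg fun e _ => edgeProb_nonneg hp hq _ _
  integrable := .of_finite
  integral_eq_one := by
    rw [integral_count, ← Fintype.prod_sum fun e => edgeProb p q (sameLabel x e)]
    simp only [sum_edgeProb, Finset.prod_const_one]

lemma ssbm2Mass_eq (n : ℕ) (p q : ℝ) (x : Fin n → Bool) (g : VPair n → Bool) :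
    ssbm2Mass n p q x g = (1 / 2) ^ n * ∏ e, edgeProb p q (sameLabel x e) (g e) := by
  simp only [ssbm2Mass, edgeProb, sameLabel, decide_eq_true_eq]

lemma miSBM_eq {p q : ℝ} (hp : p ∈ Set.Icc (0 : ℝ) 1) (hq : q ∈ Set.Icc (0 : ℝ) 1) (n : ℕ) :
    miSBM n p q = -log ((1 / 2) ^ n) -
      ∫ g, weightEntropy (fun x : Fin n → Bool =>
        (1 / 2) ^ n * ∏ e, edgeProb p q (sameLabel x e) (g e))
        ∂(Measure.count : Measure (VPair n → Bool)) := by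
  have hc : (0 : ℝ) < (1 / 2) ^ n := by positivity
  rw [← sum_integral_mul_log_eq (isProbDensity_prod_edgeProb hp hq n) hc (card_labels_mul n),
    miSBM, Finset.mul_sum]
  refine Finset.sum_congr rfl fun x _ => ?_
  rw [integral_count, Finset.mul_sum]
  refine Finset.sum_congr rfl fun g _ => ?_
  simp only [graphMarg, ssbm2Mass_eq]
  rw [mul_div_mul_left _ _ hc.ne', mul_assoc]

lemma prod_edgeProb_eq {n : ℕ} {p q r : ℝ} (hr0 : 0 < r) (hr1 : r < 1) (x : Fin n → Bool)
    (g : VPair n → Bool) :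
    ∏ e, edgeProb p q (sameLabel x e) (g e) =
      (∏ e, if g e then r else 1 - r) * ∏ e, edgeRatio p q r (sameLabel x e) (g e) := by
  rw [← Finset.prod_mul_distrib]
  refine Finset.prod_congr rfl fun e _ => ?_
  rw [edgeRatio, mul_div_cancel₀]
  split_ifs <;> linarith

lemma integral_weightEntropy_edgeProb_eq (n : ℕ) (p q : ℝ) {r : I} (hr0 : 0 < (r : ℝ))
    (hr1 : (r : ℝ) < 1) :
    ∫ g, weightEntropy (fun x : Fin n → Bool =>
        (1 / 2) ^ n * ∏ e, edgeProb p q (sameLabel x e) (g e))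
        ∂(Measure.count : Measure (VPair n → Bool)) =
      ∫ g, weightEntropy (fun x : Fin n → Bool =>
        (1 / 2) ^ n * ∏ e, edgeRatio p q r (sameLabel x e) (g e))
        ∂(Measure.pi fun _ : VPair n => bernoulliMeasure true false r) := by
  rw [integral_count, integral_fintype .of_finite]
  refine Finset.sum_congr rfl fun g _ => ?_
  simp only [prod_edgeProb_eq hr0 hr1, mul_left_comm _ (∏ e, if g e = true then (r : ℝ) else 1 - r)]
  rw [weightEntropy_const_mul, smul_eq_mul, measureReal_def, Measure.pi_singleton,
    ENNReal.toReal_prod]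
  congr 1
  refine Finset.prod_congr rfl fun e _ => ?_
  cases g e <;> simp

lemma integral_weightEntropy_pi_comp {n : ℕ} {Ω Ω' : Type*} [MeasurableSpace Ω]
    [MeasurableSpace Ω'] {μ : Measure Ω} {ν : Measure Ω'} [IsProbabilityMeasure μ]
    [IsProbabilityMeasure ν] {w : Bool → Ω' → ℝ} (hw : ∀ b, Measurable (w b)) {f : Ω → Ω'}
    (hf : MeasurePreserving f μ ν) (c : ℝ) :
    ∫ z, weightEntropy (fun x : Fin n → Bool => c * ∏ e, w (sameLabel x e) (f (z e)))
        ∂(Measure.pi fun _ : VPair n => μ) =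
      ∫ y, weightEntropy (fun x : Fin n → Bool => c * ∏ e, w (sameLabel x e) (y e))
        ∂(Measure.pi fun _ : VPair n => ν) :=
  (measurePreserving_pi (fun _ : VPair n => μ) (fun _ => ν) fun _ => hf).integral_comp_of_measurable
    (g := fun y => weightEntropy fun x : Fin n → Bool => c * ∏ e, w (sameLabel x e) (y e))
    (measurable_weightEntropy fun x => (Finset.measurable_prod _ fun e _ =>
      (hw (sameLabel x e)).comp (measurable_pi_apply e)).const_mul c)

lemma abs_miSBM_sub_miGauss_le {p q lam : ℝ} (hp : p ∈ Set.Icc (0 : ℝ) 1)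
    (hq : q ∈ Set.Icc (0 : ℝ) 1) {r : ℝ} (hr : r = (p + q) / 2) (hr0 : 0 < r) (hr1 : r < 1)
    {n : ℕ} (hn : 0 < n) (hlam : 0 < lam) (hlam' : lam / n ≤ 1 / 6) :
    |miSBM n p q - miGauss n lam| ≤ Fintype.card (VPair n) *
      ((|(p - q) ^ 2 / (r * (1 - r)) - 4 * (lam / n)| + 4 * (lam / n) ^ 2) / 8 +
        30 * (|p - q| ^ 3 / (4 * (r * (1 - r)) ^ 2) + 44 * √(lam / n) ^ 3)) := by
  lift r to I using ⟨hr0.le, hr1.le⟩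
  have ha : 0 < lam / n := by positivity
  set a := √(lam / n) with ha_def
  have ha2 : a ^ 2 = lam / n := sq_sqrt ha.le
  have ha0 : 0 < a := sqrt_pos.2 ha
  set γ : Measure ℝ := gaussianReal 0 1
  set β : Measure Bool := bernoulliMeasure true false r
  have hwE : IsBinaryChannel β (edgeRatio p q r) := isBinaryChannel_edgeRatio hp hq hr0 hr1
  have hwG : IsBinaryChannel γ fun b => gaussRatio (a * chi b) := isBinaryChannel_gaussRatio a
  have hfst : MeasurePreserving Prod.fst (γ.prod β) γ := measurePreserving_fst
  have hsnd : MeasurePreserving Prod.snd (γ.prod β) β := measurePreserving_snd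
  have hE := hwE.comp_measurePreserving hsnd
  have hG := hwG.comp_measurePreserving hfst
  have hmE : ∀ b, Measurable (edgeRatio p q r b) := fun b => (hwE.isProbDensity b).measurable
  have hmG : ∀ b, Measurable (gaussRatio (a * chi b)) := fun b => (hwG.isProbDensity b).measurable
  rw [miSBM_eq hp hq, miGauss_eq, integral_weightEntropy_edgeProb_eq n p q hr0 hr1, ← ha_def,
    ← integral_weightEntropy_pi_comp hmE hsnd,
    ← integral_weightEntropy_pi_comp (w := fun b => gaussRatio (a * chi b)) hmG hfst,
    sub_sub_sub_cancel_left, abs_sub_comm]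
  have hsum : ∑ _x : Fin n → Bool, ((1 : ℝ) / 2) ^ n = 1 := by
    rw [Finset.sum_const, Finset.card_univ, nsmul_eq_mul, card_labels_mul]
  have hδ : |∫ z, (edgeRatio p q r true (Prod.snd z) - edgeRatio p q r false (Prod.snd z)) ^ 2
        ∂(γ.prod β) -
      ∫ z, (gaussRatio (a * chi true) (Prod.fst z) - gaussRatio (a * chi false) (Prod.fst z)) ^ 2
        ∂(γ.prod β)| ≤
      |(p - q) ^ 2 / (r * (1 - r)) - 4 * (lam / n)| + 4 * (lam / n) ^ 2 := by
    rw [hsnd.integral_comp_of_measurable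
        (g := fun t => (edgeRatio p q r true t - edgeRatio p q r false t) ^ 2) .of_discrete,
      hfst.integral_comp_of_measurable
        (g := fun t => (gaussRatio (a * chi true) t - gaussRatio (a * chi false) t) ^ 2)
        (((hmG true).sub (hmG false)).pow_const 2), integral_edgeRatio_sub_sq hr0 hr1]
    have h := abs_integral_gaussRatio_sub_sq_sub_le (a := a) (by rw [ha2]; linarith)
    rw [show a ^ 4 = (a ^ 2) ^ 2 by ring, ha2, abs_sub_comm] at h
    exact (abs_sub_le _ (4 * (lam / n)) _).trans (by gcongr)
  have hrE : ∫ z, |edgeRatio p q r true (Prod.snd z) - 1| ^ 3 ∂(γ.prod β) +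
      ∫ z, |edgeRatio p q r false (Prod.snd z) - 1| ^ 3 ∂(γ.prod β) ≤
      |p - q| ^ 3 / (4 * (r * (1 - r)) ^ 2) := by
    rw [hsnd.integral_comp_of_measurable (g := fun t => |edgeRatio p q r true t - 1| ^ 3)
        .of_discrete,
      hsnd.integral_comp_of_measurable (g := fun t => |edgeRatio p q r false t - 1| ^ 3)
        .of_discrete]
    exact integral_edgeRatio_sub_one_cube_add_le hr hr0 hr1
  have hrG : ∫ z, |gaussRatio (a * chi true) (Prod.fst z) - 1| ^ 3 ∂(γ.prod β) +
      ∫ z, |gaussRatio (a * chi false) (Prod.fst z) - 1| ^ 3 ∂(γ.prod β) ≤ 44 * a ^ 3 := by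
    have h : ∀ b, ∫ z, |gaussRatio (a * chi b) (Prod.fst z) - 1| ^ 3 ∂(γ.prod β) ≤ 22 * a ^ 3 := by
      intro b
      rw [hfst.integral_comp_of_measurable (g := fun t => |gaussRatio (a * chi b) t - 1| ^ 3)
        ((_root_.continuous_abs.measurable.comp ((hmG b).sub_const 1)).pow_const 3)]
      exact integral_gaussRatio_sub_one_cube_le ha0 (by cases b <;> simp [chi]) (ha2.trans_le hlam')
    linarith [h true, h false]
  have key := abs_integral_weightEntropy_prod_sub_le (μ := γ.prod β)
    (A := fun (e : VPair n) x z => edgeRatio p q r (sameLabel x e) (Prod.snd z))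
    (B := fun (e : VPair n) x z => gaussRatio (a * chi (sameLabel x e)) (Prod.fst z))
    (fun e x => hE.isProbDensity _) (fun e x => hG.isProbDensity _)
    (fun e u hu => hE.abs_integral_weightEntropy_sub_integral_le hG (fun x => sameLabel x e)
      hδ hrE hrG u hu) (u := fun _ => (1 / 2) ^ n) fun _ => by positivity
  rwa [hsum, mul_one] at key

lemma abs_miSBM_sub_miGauss_le_mul_log {p q : ℝ} (hp : p ∈ Set.Icc (0 : ℝ) 1)
    (hq : q ∈ Set.Icc (0 : ℝ) 1) (n : ℕ) (lam : ℝ) :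
    |miSBM n p q - miGauss n lam| ≤ n * log 2 := by
  have hc : (0 : ℝ) < (1 / 2) ^ n := by positivity
  have hE := isProbDensity_prod_edgeProb hp hq n
  have hG := isProbDensity_prod_gaussRatio n (√(lam / n))
  have hlog : log (Fintype.card (Fin n → Bool)) = n * log 2 := by simp
  have h1 := integral_weightEntropy_le hE hc (card_labels_mul n)
  have h2 := integral_weightEntropy_le hG hc (card_labels_mul n)
  have h3 := integral_weightEntropy_nonneg hE hc
  have h4 := integral_weightEntropy_nonneg hG hc
  rw [miSBM_eq hp hq, miGauss_eq, sub_sub_sub_cancel_left, ← hlog]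
  exact abs_sub_le_of_nonneg_of_le h4 h2 h3 h1

lemma card_VPair_le (n : ℕ) : (Fintype.card (VPair n) : ℝ) ≤ (n : ℝ) * n := by
  have h := Fintype.card_subtype_le fun e : Fin n × Fin n => e.1 < e.2
  rw [Fintype.card_prod, Fintype.card_fin] at h
  exact_mod_cast h

lemma mul_channel_error_le {N lam P d : ℝ} (hN : 1 ≤ N) (hlam : 0 < lam) (hP : 0 < P)
    (hP1 : P ≤ 1) (hd : 0 ≤ d) (hT : N * d ^ 2 / (4 * P) ≤ 2 * lam) :
    N * ((|d ^ 2 / P - 4 * (lam / N)| + 4 * (lam / N) ^ 2) / 8 +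
        30 * (d ^ 3 / (4 * P ^ 2) + 44 * √(lam / N) ^ 3)) ≤
      (√lam / 2 + 1560) * (lam * √lam / √(N * P) + |N * d ^ 2 / (4 * P) - lam|) := by
  have hN0 : 0 < N := by linarith
  have hs : 0 < √lam := sqrt_pos.2 hlam
  have hs2 : √lam ^ 2 = lam := sq_sqrt hlam.le
  have he : 0 < √(N * P) := sqrt_pos.2 (by positivity)
  have he2 : √(N * P) ^ 2 = N * P := sq_sqrt (by positivity)
  have heN : √(N * P) ≤ √N := sqrt_le_sqrt (by nlinarith)
  have heN' : √(N * P) ≤ N := heN.trans (sqrt_le_iff.2 ⟨hN0.le, by nlinarith⟩)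
  have h1 : N * |d ^ 2 / P - 4 * (lam / N)| = 4 * |N * d ^ 2 / (4 * P) - lam| := by
    rw [← abs_of_pos hN0, ← abs_mul, abs_of_pos hN0, ← abs_of_pos (four_pos : (0 : ℝ) < 4),
      ← abs_mul, abs_of_pos (four_pos : (0 : ℝ) < 4)]
    congr 1
    field_simp
  have h2 : N * (lam / N) ^ 2 ≤ √lam * (lam * √lam / √(N * P)) := by
    calc N * (lam / N) ^ 2 = lam * lam / N := by field_simp
      _ ≤ lam * lam / √(N * P) := by gcongr
      _ = √lam * (lam * √lam / √(N * P)) := by nth_rw 2 [← hs2]; ring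
  have hdP : d / P ≤ 4 * √lam / √(N * P) := by
    refine le_of_sq_le_sq ?_ (by positivity)
    have : (d / P) ^ 2 = 4 * (N * d ^ 2 / (4 * P)) / (N * P) := by field_simp
    rw [this, div_pow, he2, mul_pow, hs2]
    exact div_le_div_of_nonneg_right (by linarith) (by positivity)
  have h3 : N * (d ^ 3 / (4 * P ^ 2)) ≤ 8 * (lam * √lam / √(N * P)) := by
    calc N * (d ^ 3 / (4 * P ^ 2)) = N * d ^ 2 / (4 * P) * (d / P) := by field_simp
      _ ≤ 2 * lam * (4 * √lam / √(N * P)) := by gcongr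
      _ = 8 * (lam * √lam / √(N * P)) := by ring
  have h4 : N * √(lam / N) ^ 3 ≤ lam * √lam / √(N * P) := by
    calc N * √(lam / N) ^ 3 = N * (√(lam / N) ^ 2 * √(lam / N)) := by ring
      _ = lam * √lam / √N := by
        rw [sq_sqrt (by positivity), sqrt_div' _ hN0.le]
        field_simp
      _ ≤ lam * √lam / √(N * P) := by gcongr
  have h5 : 0 ≤ |N * d ^ 2 / (4 * P) - lam| := abs_nonneg _
  have h6 := mul_nonneg hs.le h5
  generalize lam * √lam / √(N * P) = A at *
  generalize |N * d ^ 2 / (4 * P) - lam| = B at *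
  nlinarith

lemma abs_miSBM_sub_miGauss_div_le {p q lam : ℝ} (hp : p ∈ Set.Icc (0 : ℝ) 1)
    (hq : q ∈ Set.Icc (0 : ℝ) 1) (hlam : 0 < lam) (n : ℕ) :
    1 / (n : ℝ) * |miSBM n p q - miGauss n lam| ≤
      (√lam / 2 + 1560 + 3 / lam) *
        (lam * √lam / √(n * ((p + q) / 2 * (1 - (p + q) / 2))) +
          |n * |p - q| ^ 2 / (4 * ((p + q) / 2 * (1 - (p + q) / 2))) - lam|) := by
  set r := (p + q) / 2 with hr
  have hr0 : 0 ≤ r := by linarith [hp.1, hq.1]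
  have hr1 : r ≤ 1 := by linarith [hp.2, hq.2]
  have hP0 : 0 ≤ r * (1 - r) := mul_nonneg hr0 (by linarith)
  have hP1 : r * (1 - r) ≤ 1 := by nlinarith
  have hs : 0 < √lam := sqrt_pos.2 hlam
  set P := r * (1 - r) with hP
  set A := lam * √lam / √(n * P)
  set T := n * |p - q| ^ 2 / (4 * P)
  have hA : 0 ≤ A := by positivity
  have hAT : 0 ≤ A + |T - lam| := by positivity
  rcases n.eq_zero_or_pos with rfl | hn
  · rw [Nat.cast_zero, div_zero, zero_mul]
    positivity
  have hN : (1 : ℝ) ≤ n := by exact_mod_cast hn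
  have hN0 : (0 : ℝ) < n := by linarith
  by_cases hmain : 0 < P ∧ 6 * lam ≤ n ∧ |T - lam| ≤ lam
  · obtain ⟨hPpos, hn6, hT⟩ := hmain
    have hr0' : 0 < r := hr0.lt_of_ne fun h => by rw [hP, ← h, zero_mul] at hPpos; exact hPpos.false
    have hr1' : r < 1 := hr1.lt_of_ne fun h => by
      rw [hP, h, sub_self, mul_zero] at hPpos; exact hPpos.false
    have hle := abs_miSBM_sub_miGauss_le hp hq hr hr0' hr1' hn hlam (by
      rw [div_le_div_iff₀ hN0 (by norm_num)]; linarith)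
    rw [← hP, ← sq_abs (p - q)] at hle
    have herr := mul_channel_error_le hN hlam hPpos hP1 (abs_nonneg (p - q))
      (by linarith [(abs_le.1 hT).2])
    set E := (|(|p - q| ^ 2 / P) - 4 * (lam / n)| + 4 * (lam / n) ^ 2) / 8 +
        30 * (|p - q| ^ 3 / (4 * P ^ 2) + 44 * √(lam / n) ^ 3)
    have hE : 0 ≤ E := by positivity
    calc 1 / (n : ℝ) * |miSBM n p q - miGauss n lam| ≤ 1 / (n : ℝ) * (n * n * E) := by
          gcongr
          exact hle.trans (mul_le_mul_of_nonneg_right (card_VPair_le n) hE)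
      _ = n * E := by field_simp
      _ ≤ (√lam / 2 + 1560) * (A + |T - lam|) := herr
      _ ≤ _ := mul_le_mul_of_nonneg_right (by linarith [div_pos three_pos hlam]) hAT
  · have htriv : 1 / (n : ℝ) * |miSBM n p q - miGauss n lam| ≤ 1 := by
      calc _ ≤ 1 / (n : ℝ) * (n * log 2) := by
            gcongr
            exact abs_miSBM_sub_miGauss_le_mul_log hp hq n lam
        _ = log 2 := by field_simp
        _ ≤ 1 := by linarith [log_two_lt_d9]
    have hlow : lam / 3 ≤ A + |T - lam| := by
      by_cases hPpos : 0 < P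
      · by_cases hn6 : 6 * lam ≤ n
        · have : lam < |T - lam| := not_le.1 fun h => hmain ⟨hPpos, hn6, h⟩
          linarith
        · have hsq : √(n * P) ≤ 3 * √lam := by
            rw [sqrt_le_iff, mul_pow, sq_sqrt hlam.le]
            exact ⟨by positivity, by nlinarith⟩
          have : lam / 3 ≤ A := by
            rw [div_le_div_iff₀ three_pos (sqrt_pos.2 (by positivity))]
            nlinarith
          linarith [abs_nonneg (T - lam)]
      · have hT0 : T = 0 := by
          rw [show T = n * |p - q| ^ 2 / (4 * P) from rfl, le_antisymm (not_lt.1 hPpos) hP0,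
            mul_zero, div_zero]
        rw [hT0, zero_sub, abs_neg, abs_of_pos hlam]
        linarith
    calc _ ≤ (1 : ℝ) := htriv
      _ = 3 / lam * (lam / 3) := by field_simp
      _ ≤ 3 / lam * (A + |T - lam|) := by gcongr
      _ ≤ _ := mul_le_mul_of_nonneg_right (by linarith) hAT

end Entropy

/-- Equivalence of the SBM and the Gaussian (spiked Wigner) model: the per-vertex
mutual informations differ by at most
`C (λ^{3/2}/√(n(pₙ+qₙ)/2 (1−(pₙ+qₙ)/2)) + |SNRₙ − λ|)`. -/
theorem sbm_gaussian_equivalence (p q : ℕ → ℝ)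
    (hp : ∀ n, p n ∈ Set.Icc (0 : ℝ) 1) (hq : ∀ n, q n ∈ Set.Icc (0 : ℝ) 1)
    (lam : ℝ) (hlam : 0 < lam) :
    ∃ C : ℝ, ∀ n : ℕ,
      (1 / (n : ℝ)) * |miSBM n (p n) (q n) - miGauss n lam| ≤
        C * (lam ^ ((3 : ℝ) / 2) /
              Real.sqrt ((n : ℝ) * (p n + q n) / 2 * (1 - (p n + q n) / 2)) +
            |(n : ℝ) * (p n - q n) ^ 2 /
                (2 * (p n + q n) * (1 - (p n + q n) / 2)) - lam|) := by
  refine ⟨√lam / 2 + 1560 + 3 / lam, fun n => ?_⟩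
  have h := abs_miSBM_sub_miGauss_div_le (hp n) (hq n) hlam n
  have hpow : lam ^ ((3 : ℝ) / 2) = lam * √lam := by
    rw [show (3 : ℝ) / 2 = 1 + 1 / 2 by norm_num, Real.rpow_add hlam, Real.rpow_one,
      Real.sqrt_eq_rpow]
  rw [hpow]
  convert h using 5
  · ring
  · rw [sq_abs]
    ring
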